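/- arXiv:1205.5077 — 3 statements merged into one kernel-verified Lean document; each statement's English description precedes it below -/
import Mathlib

section
/- For every integer N with 5 ≤ N ≤ 22, or 24 ≤ N ≤ 28, or N = 30, or N = 36, the complex vector space S₁(Γ₁(N); ℂ) of weight 1 cusp forms of level Γ₁(N) is zero, i.e., has dimension 0 over ℂ. -/
open UpperHalfPlane ModularForm CongruenceSubgroup Filter Asymptotics MatrixGroups

open Matrix.SpecialLinearGroup (mapGL mapGL_injective)

open scoped Topology Pointwise

/-- A modular form of level one and weight `k` that decays at `i∞` like `q ^ r` with `k < 12 * r`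
is zero. -/
theorem ModularForm.levelOne_eq_zero_of_isBigO_exp {k : ℤ} {r : ℝ} (f : ModularForm 𝒮ℒ k)
    (hf : (f : ℍ → ℂ) =O[atImInfty] fun τ ↦ Real.exp (-2 * Real.pi * r * τ.im))
    (hk : k < 12 * r) : f = 0 := by
  obtain ⟨n, hn⟩ : ∃ n : ℕ, k < 12 * (n : ℤ) := ⟨k.toNat + 1, by lia⟩
  induction n generalizing k r with
  | zero => exact rank_zero_iff_forall_zero.mp (levelOne_neg_weight_rank_zero (by lia)) f
  | succ n ih =>
    rcases lt_or_ge k 0 with hneg | hnonneg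
    · exact rank_zero_iff_forall_zero.mp (levelOne_neg_weight_rank_zero hneg) f
    have hr : 0 < r := by
      have : (0 : ℝ) ≤ k := mod_cast hnonneg
      linarith
    have hzero : IsZeroAtImInfty f := by
      refine hf.trans_tendsto (Real.tendsto_exp_atBot.comp ?_)
      exact tendsto_comap.const_mul_atTop_of_neg (by nlinarith [Real.pi_pos, mul_pos Real.pi_pos hr])
    have h0 : (qExpansion 1 f).coeff 0 = 0 := by
      rw [qExpansion_coeff_zero one_pos
        (ModularFormClass.analyticAt_cuspFunction_zero _ one_pos one_mem_strictPeriods_SL)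
        (SlashInvariantFormClass.periodic_comp_ofComplex _ one_mem_strictPeriods_SL)]
      exact hzero.valueAtInfty_eq_zero
    suffices CuspForm.discriminantEquiv (toCuspForm f h0) = 0 by
      simpa [CuspForm.discriminantEquiv.map_eq_zero_iff, DFunLike.ext_iff]
    refine ih (r := r - 1) _ ?_ (by push_cast; linarith) (by push_cast at hn; lia)
    have hΔ : (fun τ : ℍ ↦ (ModularForm.discriminant τ)⁻¹) =O[atImInfty]
        fun τ ↦ (Real.exp (-2 * Real.pi * τ.im))⁻¹ :=
      exp_isBigO_discriminant.inv_rev (.of_forall fun τ h ↦ absurd h (Real.exp_ne_zero _))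
    refine (hf.mul hΔ).congr (fun τ ↦ ?_) fun τ ↦ ?_
    · simp [CuspForm.discriminantEquiv_apply, div_eq_mul_inv]
    · rw [← Real.exp_neg, ← Real.exp_add]
      ring_nf

/-- A pair of integers that is primitive modulo `N` is congruent modulo `N` to a coprime pair. -/
theorem Nat.exists_coprime_modEq_of_gcd_gcd_eq_one {N c d : ℕ} (hN : 0 < N)
    (h : (c.gcd d).gcd N = 1) : ∃ c' d' : ℕ, c'.Coprime d' ∧ c' ≡ c [MOD N] ∧ d' ≡ d [MOD N] := by
  let ps : Finset ℕ := {p ∈ (c + N).primeFactors | ¬p ∣ d}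
  refine ⟨c + N, d + ps.prod id * N, Nat.coprime_of_dvd fun p pp hpc hpd ↦ ?_,
    by simp [Nat.ModEq], by simp [Nat.ModEq]⟩
  by_cases hpx : p ∣ d
  · rcases pp.dvd_mul.mp ((Nat.dvd_add_right hpx).mp hpd) with hp | hp
    · obtain ⟨q, hq, hpq⟩ := (pp.prime.dvd_finsetProd_iff _).mp hp
      simp only [ps, Finset.mem_filter, Nat.mem_primeFactors] at hq
      exact hq.2 (((Nat.prime_dvd_prime_iff_eq pp hq.1.1).mp hpq) ▸ hpx)
    · exact pp.not_dvd_one (h ▸ Nat.dvd_gcd (Nat.dvd_gcd ((Nat.dvd_add_left hp).mp hpc) hpx) hp)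
  · have hps : p ∈ ps := by simp [ps, pp, hpc, hpx, hN.ne']
    exact hpx ((Nat.dvd_add_left ((Finset.dvd_prod_of_mem id hps).mul_right N)).mp hpd)

namespace CongruenceSubgroup

/-- The bottom rows modulo `N` of elements of `SL(2, ℤ)`. -/
def bottomRows (N : ℕ) : Finset (ℕ × ℕ) :=
  {p ∈ Finset.range N ×ˢ Finset.range N | (p.1.gcd p.2).gcd N = 1}

theorem exists_SL_of_mem_bottomRows {N : ℕ} (p : bottomRows N) :
    ∃ γ : SL(2, ℤ), (γ 1 0 : ZMod N) = p.1.1 ∧ (γ 1 1 : ZMod N) = p.1.2 := by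
  obtain ⟨⟨c, d⟩, hp⟩ := p
  simp only [bottomRows, Finset.mem_filter, Finset.mem_product, Finset.mem_range] at hp
  obtain ⟨c', d', hcop, hc, hd⟩ :=
    Nat.exists_coprime_modEq_of_gcd_gcd_eq_one (by lia) hp.2
  obtain ⟨γ, -, hγ⟩ := ModularGroup.bottom_row_surj (R := ℤ)
    (show ![(c' : ℤ), d'] ∈ {cd : Fin 2 → ℤ | IsCoprime (cd 0) (cd 1)} by
      simpa using Nat.isCoprime_iff_coprime.mpr hcop)
  have h0 := congr_fun hγ 0
  have h1 := congr_fun hγ 1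
  simp only [Matrix.cons_val_zero, Matrix.cons_val_one] at h0 h1
  refine ⟨γ, ?_, ?_⟩
  · simpa [h0] using (ZMod.natCast_eq_natCast_iff _ _ _).mpr hc
  · simpa [h1] using (ZMod.natCast_eq_natCast_iff _ _ _).mpr hd

/-- A matrix in `SL(2, ℤ)` with prescribed bottom row modulo `N`. -/
noncomputable def bottomRowRep {N : ℕ} (p : bottomRows N) : SL(2, ℤ) :=
  (exists_SL_of_mem_bottomRows p).choose

theorem bottomRowRep_apply {N : ℕ} (p : bottomRows N) :
    (bottomRowRep p 1 0 : ZMod N) = p.1.1 ∧ (bottomRowRep p 1 1 : ZMod N) = p.1.2 :=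
  (exists_SL_of_mem_bottomRows p).choose_spec

theorem exists_bottomRow {N : ℕ} [NeZero N] (γ : SL(2, ℤ)) :
    ∃ p : bottomRows N, (γ 1 0 : ZMod N) = p.1.1 ∧ (γ 1 1 : ZMod N) = p.1.2 := by
  refine ⟨⟨((γ 1 0 : ZMod N).val, (γ 1 1 : ZMod N).val), ?_⟩, by simp, by simp⟩
  simp only [bottomRows, Finset.mem_filter, Finset.mem_product, Finset.mem_range, ZMod.val_lt,
    true_and, and_self]
  set g := ((γ 1 0 : ZMod N).val.gcd (γ 1 1 : ZMod N).val).gcd N with hg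
  have key (x : ℤ) (hx : g ∣ (x : ZMod N).val) : (g : ℤ) ∣ x := by
    have hgN : (g : ℤ) ∣ N := mod_cast Nat.gcd_dvd_right _ _
    rwa [← Int.natCast_dvd_natCast, ZMod.val_intCast, Int.emod_def,
      dvd_sub_left (hgN.mul_right _)] at hx
  have h0 := key _ ((Nat.gcd_dvd_left _ N).trans (Nat.gcd_dvd_left _ _))
  have h1 := key _ ((Nat.gcd_dvd_left _ N).trans (Nat.gcd_dvd_right _ _))
  exact Nat.isUnit_iff.mp <| Int.ofNat_isUnit.mp <|
    (ModularGroup.bottom_row_coprime γ).isUnit_of_dvd' h0 h1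

theorem intCast_det_eq_one (N : ℕ) (γ : SL(2, ℤ)) :
    (γ 0 0 * γ 1 1 - γ 0 1 * γ 1 0 : ZMod N) = 1 := by
  have := γ.det_coe
  rw [Matrix.det_fin_two] at this
  exact_mod_cast congr_arg (Int.cast : ℤ → ZMod N) this

theorem mul_inv_mem_Gamma1_iff {N : ℕ} (γ δ : SL(2, ℤ)) : γ * δ⁻¹ ∈ Gamma1 N ↔
    (γ 1 0 : ZMod N) = δ 1 0 ∧ (γ 1 1 : ZMod N) = δ 1 1 := by
  have hγ := intCast_det_eq_one N γ
  have hδ := intCast_det_eq_one N δ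
  simp only [Gamma1_mem, Matrix.SpecialLinearGroup.coe_mul, Matrix.SpecialLinearGroup.coe_inv,
    Matrix.adjugate_fin_two, Matrix.mul_apply, Fin.sum_univ_two, Matrix.of_apply,
    Matrix.cons_val_zero, Matrix.cons_val_one, Matrix.cons_val', Matrix.cons_val_fin_one]
  push_cast
  refine ⟨fun ⟨_, h1, h2⟩ ↦ ⟨?_, ?_⟩, fun ⟨h1, h2⟩ ↦ ⟨?_, ?_, ?_⟩⟩
  · linear_combination (-(γ 1 0 : ZMod N)) * hδ + (δ 0 0 : ZMod N) * h2 + (δ 1 0 : ZMod N) * h1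
  · linear_combination (-(γ 1 1 : ZMod N)) * hδ + (δ 0 1 : ZMod N) * h2 + (δ 1 1 : ZMod N) * h1
  · linear_combination hγ + (γ 0 1 : ZMod N) * h1 - (γ 0 0 : ZMod N) * h2
  · linear_combination hδ - (δ 0 1 : ZMod N) * h1 + (δ 0 0 : ZMod N) * h2
  · linear_combination (δ 1 1 : ZMod N) * h1 - (δ 1 0 : ZMod N) * h2

theorem conj_T_zpow_mem_Gamma1 {N : ℕ} (γ : SL(2, ℤ)) {h : ℤ}
    (hh : (γ 1 0 * h : ZMod N) = 0) : γ * ModularGroup.T ^ h * γ⁻¹ ∈ Gamma1 N := by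
  rw [mul_inv_mem_Gamma1_iff, Matrix.SpecialLinearGroup.coe_mul, ModularGroup.coe_T_zpow]
  simp [Matrix.mul_apply, Fin.sum_univ_two, hh]

end CongruenceSubgroup

section Norm

variable {N : ℕ} {k : ℤ}

/-- The slash of a cusp form for `Γ₁(N)` by a matrix with lower left entry `c` modulo `N` has
period `N / gcd (c, N)`, which bounds its decay at `i∞`. -/
theorem CuspForm.slash_isBigO_exp [NeZero N] (f : CuspForm (Gamma1 N) k) (γ : SL(2, ℤ)) {c : ℕ}
    (hc : (γ 1 0 : ZMod N) = c) :
    ((f : ℍ → ℂ) ∣[k] γ) =O[atImInfty]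
      fun τ ↦ Real.exp (-2 * Real.pi * ((c.gcd N : ℝ) / N) * τ.im) := by
  have hN : 0 < N := NeZero.pos N
  obtain ⟨m, hm⟩ := c.gcd_dvd_right N
  have hm0 : 0 < m := Nat.pos_of_mul_pos_left (hm ▸ hN)
  have hper : (m : ℝ) ∈ (ConjAct.toConjAct (mapGL ℝ γ)⁻¹ •
      (Gamma1 N : Subgroup (GL (Fin 2) ℝ))).strictPeriods := by
    have hT : Matrix.GeneralLinearGroup.upperRightHom (m : ℝ) =
        mapGL ℝ (ModularGroup.T ^ (m : ℤ)) := by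
      ext i j
      fin_cases i <;> fin_cases j <;>
        simp [ModularGroup.coe_T_zpow, Matrix.GeneralLinearGroup.upperRightHom, -map_zpow,
          -zpow_natCast]
    rw [Subgroup.mem_strictPeriods_iff, Subgroup.mem_pointwise_smul_iff_inv_smul_mem, hT,
      ConjAct.smul_def, ← ConjAct.toConjAct_inv, ConjAct.ofConjAct_toConjAct, inv_inv]
    refine ⟨_, conj_T_zpow_mem_Gamma1 γ (h := m) ?_, by simp⟩
    obtain ⟨a, ha⟩ := c.gcd_dvd_left N
    rw [hc, Int.cast_natCast, ← Nat.cast_mul, ZMod.natCast_eq_zero_iff]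
    exact ⟨a, by conv_lhs => rw [ha]
                 conv_rhs => rw [hm]
                 ring⟩
  refine (CuspFormClass.exp_decay_atImInfty (h := m) (CuspForm.translate f (mapGL ℝ γ))
    (mod_cast hm0) hper).congr_right fun τ ↦ ?_
  have : (N : ℝ) = c.gcd N * m := mod_cast hm
  have hg : (c.gcd N : ℝ) ≠ 0 := mod_cast (Nat.gcd_pos_of_pos_right c hN).ne'
  rw [this]
  congr 1
  field_simp

theorem mk_mapGL_eq_iff (γ δ : SL(2, ℤ)) :
    (QuotientGroup.mk ⟨mapGL ℝ γ⁻¹, ⟨_, rfl⟩⟩ :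
      𝒮ℒ ⧸ (Gamma1 N : Subgroup (GL (Fin 2) ℝ)).subgroupOf 𝒮ℒ) =
      QuotientGroup.mk ⟨mapGL ℝ δ⁻¹, ⟨_, rfl⟩⟩ ↔
    (γ 1 0 : ZMod N) = δ 1 0 ∧ (γ 1 1 : ZMod N) = δ 1 1 := by
  rw [QuotientGroup.eq, Subgroup.mem_subgroupOf, ← mul_inv_mem_Gamma1_iff,
    ← Subgroup.mem_map_iff_mem (mapGL_injective (S := ℝ))]
  simp

/-- Bottom rows modulo `N` parametrise the cosets of `Γ₁(N)` in `SL(2, ℤ)`. -/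
noncomputable def bottomRowsEquiv (N : ℕ) [NeZero N] :
    bottomRows N ≃ 𝒮ℒ ⧸ (Gamma1 N : Subgroup (GL (Fin 2) ℝ)).subgroupOf 𝒮ℒ :=
  .ofBijective (fun p ↦ QuotientGroup.mk ⟨mapGL ℝ (bottomRowRep p)⁻¹, ⟨_, rfl⟩⟩) <| by
    constructor
    · intro p q hpq
      rw [mk_mapGL_eq_iff, (bottomRowRep_apply p).1, (bottomRowRep_apply p).2,
        (bottomRowRep_apply q).1, (bottomRowRep_apply q).2,
        ZMod.natCast_eq_natCast_iff', ZMod.natCast_eq_natCast_iff'] at hpq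
      obtain ⟨⟨a, b⟩, hp⟩ := p
      obtain ⟨⟨c, d⟩, hq⟩ := q
      simp only [bottomRows, Finset.mem_filter, Finset.mem_product, Finset.mem_range] at hp hq
      simpa [Nat.mod_eq_of_lt, hp.1.1, hp.1.2, hq.1.1, hq.1.2] using hpq
    · intro q
      obtain ⟨⟨_, γ, rfl⟩, rfl⟩ := QuotientGroup.mk_surjective q
      obtain ⟨p, hp⟩ := exists_bottomRow (N := N) γ⁻¹
      refine ⟨p, ?_⟩
      have := (mk_mapGL_eq_iff (N := N) (bottomRowRep p) γ⁻¹).mpr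
        ⟨(bottomRowRep_apply p).1.trans hp.1.symm, (bottomRowRep_apply p).2.trans hp.2.symm⟩
      simpa only [inv_inv] using this

/-- A cusp form of weight `k` for `Γ₁(N)` is zero if the forced zeros of its norm to level one,
`∑ gcd (c, N) / N` over the cosets with bottom row `(c, d)`, exceed the weight of that norm divided
by `12`. -/
theorem CuspForm.eq_zero_of_lt_sum_gcd [NeZero N]
    (hN : k * (N * (bottomRows N).card) < 12 * ∑ p ∈ bottomRows N, p.1.gcd N)
    (f : CuspForm (Gamma1 N) k) : f = 0 := by
  have hN0 : (0 : ℝ) < N := mod_cast NeZero.pos N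
  rw [← FunLike.coe_zero_iff, ← ModularForm.norm_eq_zero_iff 𝒮ℒ f]
  refine ModularForm.levelOne_eq_zero_of_isBigO_exp
    (r := ∑ p : bottomRows N, (p.1.1.gcd N : ℝ) / N) _ ?_ ?_
  · let := Fintype.ofFinite (𝒮ℒ ⧸ (Gamma1 N : Subgroup (GL (Fin 2) ℝ)).subgroupOf 𝒮ℒ)
    have hnorm : (ModularForm.norm 𝒮ℒ f : ℍ → ℂ) =
        fun τ ↦ ∏ p : bottomRows N, ((f : ℍ → ℂ) ∣[k] bottomRowRep p) τ := by
      rw [ModularForm.coe_norm, ← (bottomRowsEquiv N).prod_comp, ← Finset.prod_fn]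
      refine Finset.prod_congr rfl fun p _ ↦ ?_
      simp [bottomRowsEquiv, ModularForm.SL_slash, mapGL]
      rfl
    rw [hnorm]
    refine (IsBigO.finsetProd fun p _ ↦ f.slash_isBigO_exp (bottomRowRep p)
      (bottomRowRep_apply p).1).congr_right fun τ ↦ ?_
    rw [← Real.exp_sum, Finset.mul_sum, Finset.sum_mul]
  · rw [← Nat.card_congr (bottomRowsEquiv N), Nat.card_eq_fintype_card, Fintype.card_coe,
      Finset.sum_coe_sort (bottomRows N) fun p ↦ (p.1.gcd N : ℝ) / N, ← Finset.sum_div,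
      mul_div_assoc', lt_div_iff₀ hN0]
    have : (k * (N * (bottomRows N).card) : ℝ) < 12 * ∑ p ∈ bottomRows N, p.1.gcd N := by
      exact_mod_cast hN
    push_cast at this ⊢
    linarith

end Norm

theorem weight_one_cuspforms_rank_zero_small_levels (N : ℕ)
    (h : (5 ≤ N ∧ N ≤ 22) ∨ (24 ≤ N ∧ N ≤ 28) ∨ N = 30 ∨ N = 36) :
    Module.rank ℂ (CuspForm (CongruenceSubgroup.Gamma1 N) 1) = 0 := by
  have : NeZero N := ⟨by lia⟩
  refine rank_zero_iff_forall_zero.mpr (CuspForm.eq_zero_of_lt_sum_gcd ?_)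
  have hN : N ∈ Finset.Icc 5 22 ∪ Finset.Icc 24 28 ∪ {30, 36} := by
    simp only [Finset.mem_union, Finset.mem_Icc, Finset.mem_insert, Finset.mem_singleton]
    lia
  have key : ∀ M ∈ Finset.Icc 5 22 ∪ Finset.Icc 24 28 ∪ {30, 36},
      M * (bottomRows M).card < 12 * ∑ p ∈ bottomRows M, p.1.gcd M := by
    decide +kernel
  rw [one_mul]
  exact_mod_cast key N hN
end

section
/- For every positive integer N with N < 23, the complex vector space S₁(Γ₁(N); ℂ) of weight 1 cusp forms of level Γ₁(N) is zero, i.e., has dimension 0 over ℂ. -/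
open UpperHalfPlane ModularForm CongruenceSubgroup Matrix Matrix.SpecialLinearGroup Filter Asymptotics
open scoped MatrixGroups Real Topology

namespace ModularForm

/-- A level one form of weight `k` which is `O(q ^ s)` at infinity with `k < 12 * s` is zero. -/
lemma levelOne_eq_zero_of_isBigO_exp_s3 {k : ℤ} (f : ModularForm 𝒮ℒ k) {s : ℝ} (hs : k < 12 * s)
    (hf : f =O[atImInfty] fun τ ↦ Real.exp (-2 * π * τ.im * s)) : f = 0 := by
  obtain ⟨n, hn⟩ : ∃ n : ℕ, k < 12 * n := ⟨k.toNat + 1, by lia⟩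
  induction n generalizing k s with
  | zero => exact rank_zero_iff_forall_zero.mp (levelOne_neg_weight_rank_zero (by lia)) f
  | succ n ih =>
    rcases lt_or_ge k 0 with hk | hk
    · exact rank_zero_iff_forall_zero.mp (levelOne_neg_weight_rank_zero hk) f
    have hs0 : 0 < s := by
      have : (0 : ℝ) ≤ k := mod_cast hk
      linarith
    have hzero : IsZeroAtImInfty f := by
      refine hf.trans_tendsto (Real.tendsto_exp_atBot.comp ?_)
      have him : Tendsto (fun τ : ℍ ↦ τ.im) atImInfty atTop := tendsto_comap
      refine (him.const_mul_atTop_of_neg (show -2 * π * s < 0 by nlinarith [Real.pi_pos])).congr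
        fun τ ↦ by ring
    have hcoeff : (qExpansion 1 f).coeff 0 = 0 := by
      rw [qExpansion_coeff_zero one_pos
        (ModularFormClass.analyticAt_cuspFunction_zero f one_pos one_mem_strictPeriods_SL)
        (SlashInvariantFormClass.periodic_comp_ofComplex f one_mem_strictPeriods_SL)]
      exact hzero.valueAtInfty_eq_zero
    suffices CuspForm.discriminantEquiv (toCuspForm f hcoeff) = 0 by
      simpa [CuspForm.discriminantEquiv.map_eq_zero_iff, DFunLike.ext_iff] using this
    refine ih (s := s - 1) _ (by push_cast; linarith) ?_ (by push_cast at hn; lia)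
    have hinv := exp_isBigO_discriminant.inv_rev
      (Eventually.of_forall fun τ h ↦ absurd h (Real.exp_ne_zero _))
    refine (hf.mul hinv).congr (fun τ ↦ ?_) fun τ ↦ ?_
    · simp [CuspForm.discriminantEquiv_apply, div_eq_mul_inv]
    · simp only [← Real.exp_neg, ← Real.exp_add]
      ring_nf

end ModularForm

namespace CuspForm

lemma slash_isBigO_exp_s3 {Γ : Subgroup SL(2, ℤ)} {k : ℤ} (f : CuspForm Γ k) [Γ.FiniteIndex]
    (g : SL(2, ℤ)) {w : ℕ} (hw : 0 < w) (hg : g * ModularGroup.T ^ w * g⁻¹ ∈ Γ) :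
    ((f : ℍ → ℂ) ∣[k] g) =O[atImInfty] fun τ ↦ Real.exp (-2 * π * τ.im / w) := by
  refine CuspFormClass.exp_decay_atImInfty (CuspForm.translate f (mapGL ℝ g))
    (mod_cast hw : (0 : ℝ) < w) ?_
  rw [Subgroup.mem_strictPeriods_iff, map_inv, Subgroup.mem_inv_pointwise_smul_iff,
    ConjAct.toConjAct_smul]
  refine ⟨_, hg, ?_⟩
  rw [map_mul, map_mul, map_inv]
  congr 2
  ext i j
  rw [← zpow_natCast]
  fin_cases i <;> fin_cases j <;>
    simp [ModularGroup.coe_T_zpow, mapGL_coe_matrix, -zpow_natCast, -map_zpow]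

end CuspForm

namespace CongruenceSubgroup

/-- The pairs `(a, c)` in `[0, N)²` with `gcd (a, c, N) = 1`. -/
def primitivePairs (N : ℕ) : Finset (ℕ × ℕ) :=
  {v ∈ Finset.range N ×ˢ Finset.range N | (v.1.gcd v.2).gcd N = 1}

/-- The residues modulo `N` of the first column of a matrix. -/
def firstCol (N : ℕ) (g : SL(2, ℤ)) : ℕ × ℕ :=
  ((g 0 0 : ZMod N).val, (g 1 0 : ZMod N).val)

variable {N : ℕ}

lemma inv_mul_mem_Gamma1_iff [NeZero N] {g g' : SL(2, ℤ)} :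
    g⁻¹ * g' ∈ Gamma1 N ↔ firstCol N g = firstCol N g' := by
  have hdet := congrArg (Int.cast : ℤ → ZMod N) g.det_coe
  have hdet' := congrArg (Int.cast : ℤ → ZMod N) g'.det_coe
  rw [det_fin_two] at hdet hdet'
  push_cast at hdet hdet'
  simp only [firstCol, Prod.mk.injEq, (ZMod.val_injective N).eq_iff, Gamma1_mem,
    Matrix.SpecialLinearGroup.coe_mul, coe_inv, adjugate_fin_two]
  simp only [mul_apply, Fin.sum_univ_two, of_apply, cons_val', cons_val_zero, cons_val_one,
    cons_val_fin_one]
  push_cast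
  constructor
  · rintro ⟨h1, h2, h3⟩
    constructor <;> grind
  · rintro ⟨h1, h2⟩
    refine ⟨?_, ?_, ?_⟩ <;> grind

lemma firstCol_mem [NeZero N] (g : SL(2, ℤ)) : firstCol N g ∈ primitivePairs N := by
  simp only [primitivePairs, firstCol, Finset.mem_filter, Finset.mem_product, Finset.mem_range,
    ZMod.val_lt, true_and, and_self]
  obtain ⟨x, y, hxy⟩ := g.isCoprime_col 0
  set d := ((g 0 0 : ZMod N).val.gcd (g 1 0 : ZMod N).val).gcd N
  have hN : (d : ℤ) ∣ N := mod_cast Nat.gcd_dvd_right _ _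
  have key (z : ℤ) (hz : d ∣ (z : ZMod N).val) : (d : ℤ) ∣ z := by
    have := Int.natCast_dvd_natCast.mpr hz
    rw [ZMod.val_intCast] at this
    rw [← Int.emod_add_mul_ediv z N]
    exact dvd_add this (hN.mul_right _)
  have h0 := key _ ((Nat.gcd_dvd_left _ _).trans (Nat.gcd_dvd_left _ _))
  have h1 := key _ ((Nat.gcd_dvd_left _ _).trans (Nat.gcd_dvd_right _ _))
  have : (d : ℤ) ∣ 1 := hxy ▸ dvd_add (h0.mul_left x) (h1.mul_left y)
  exact Nat.dvd_one.mp (mod_cast this)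

lemma exists_isCoprime_of_gcd_eq_one [NeZero N] {a c : ℕ} (h : (a.gcd c).gcd N = 1) :
    ∃ a' c' : ℤ, (a' : ZMod N) = a ∧ (c' : ZMod N) = c ∧ IsCoprime a' c' := by
  have : NeZero (c + N) := ⟨by have := NeZero.ne N; lia⟩
  have hcop : a.Coprime ((c + N).gcd N) := by
    rwa [Nat.gcd_add_self_left, Nat.Coprime, ← Nat.gcd_assoc]
  obtain ⟨u, hu⟩ := ZMod.unitsMap_surjective (Nat.gcd_dvd_left (c + N) N)
    (ZMod.unitOfCoprime a hcop)
  have hu' : ((u.val.val : ℤ) : ZMod ((c + N).gcd N)) = (a : ℤ) := by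
    have := congrArg Units.val hu
    rw [ZMod.unitsMap_val, ZMod.coe_unitOfCoprime] at this
    rw [Int.cast_natCast, Int.cast_natCast, ← this, ZMod.natCast_val]
  rw [ZMod.intCast_eq_intCast_iff_dvd_sub] at hu'
  obtain ⟨m, hm⟩ := hu'
  have hbez := Nat.gcd_eq_gcd_ab (c + N) N
  set x := (c + N).gcdA N
  set y := (c + N).gcdB N
  refine ⟨u.val.val + (c + N : ℕ) * (x * m), (c + N : ℕ), ?_, by simp, ?_⟩
  · have : (u.val.val + (c + N : ℕ) * (x * m) : ℤ) = a - N * (y * m) := by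
      rw [hbez] at hm
      linear_combination -hm
    rw [this]
    simp
  · exact (Nat.isCoprime_iff_coprime.mpr (ZMod.val_coe_unit_coprime u)).add_mul_left_left _

lemma exists_firstCol_eq [NeZero N] {v : ℕ × ℕ} (hv : v ∈ primitivePairs N) :
    ∃ g, firstCol N g = v := by
  simp only [primitivePairs, Finset.mem_filter, Finset.mem_product, Finset.mem_range] at hv
  obtain ⟨a, c, ha, hc, hac⟩ := exists_isCoprime_of_gcd_eq_one hv.2
  obtain ⟨g, hg0, hg1⟩ := hac.exists_SL2_col 0
  exact ⟨g, by simp [firstCol, hg0, hg1, ha, hc, Nat.mod_eq_of_lt, hv.1]⟩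

lemma inv_mul_T_pow_mul_mem_Gamma1 [NeZero N] (g : SL(2, ℤ)) :
    g⁻¹ * ModularGroup.T ^ (N / (firstCol N g).2.gcd N) * g⁻¹⁻¹ ∈ Gamma1 N := by
  set w := N / (firstCol N g).2.gcd N
  have hw : (w : ZMod N) * (g 1 0 : ZMod N) = 0 := by
    rw [← ZMod.natCast_zmod_val (g 1 0 : ZMod N), ← Nat.cast_mul, ZMod.natCast_eq_zero_iff]
    change N ∣ N / (firstCol N g).2.gcd N * (firstCol N g).2
    rw [Nat.div_mul_right_comm (Nat.gcd_dvd_right _ _), Nat.mul_div_assoc _ (Nat.gcd_dvd_left _ _)]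
    exact dvd_mul_right _ _
  rw [mul_assoc, inv_inv, inv_mul_mem_Gamma1_iff, firstCol, firstCol,
    Matrix.SpecialLinearGroup.coe_mul]
  have := ModularGroup.coe_T_zpow w
  rw [zpow_natCast] at this
  simp [this, Matrix.mul_apply, Fin.sum_univ_two, hw]

/-- The cosets of `Gamma1 N` in `SL(2, ℤ)` correspond to the primitive pairs, via the first column
of a coset representative. -/
lemma exists_quotient_equiv_primitivePairs (N : ℕ) [NeZero N] :
    ∃ e : 𝒮ℒ ⧸ (Gamma1 N : Subgroup (GL (Fin 2) ℝ)).subgroupOf 𝒮ℒ ≃ primitivePairs N, ∀ q,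
      ∃ g : SL(2, ℤ), ⟦⟨mapGL ℝ g, g, rfl⟩⟧ = q ∧ firstCol N g = e q := by
  have hrep (q : 𝒮ℒ ⧸ (Gamma1 N : Subgroup (GL (Fin 2) ℝ)).subgroupOf 𝒮ℒ) :
      ∃ g : SL(2, ℤ), ⟦⟨mapGL ℝ g, g, rfl⟩⟧ = q := by
    induction q using Quotient.inductionOn with
    | h r =>
      obtain ⟨_, g, rfl⟩ := r
      exact ⟨g, rfl⟩
  have heq (g g' : SL(2, ℤ)) :
      (⟦⟨mapGL ℝ g, g, rfl⟩⟧ : 𝒮ℒ ⧸ (Gamma1 N : Subgroup (GL (Fin 2) ℝ)).subgroupOf 𝒮ℒ) =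
        ⟦⟨mapGL ℝ g', g', rfl⟩⟧ ↔ firstCol N g = firstCol N g' := by
    rw [← inv_mul_mem_Gamma1_iff, Quotient.eq, QuotientGroup.leftRel_apply, Subgroup.mem_subgroupOf,
      ← Subgroup.mem_map_iff_mem (mapGL_injective (S := ℝ)), map_mul, map_inv]
    rfl
  choose g hg using hrep
  refine ⟨.ofBijective (fun q ↦ ⟨firstCol N (g q), firstCol_mem _⟩) ⟨fun q q' h ↦ ?_, fun v ↦ ?_⟩,
    fun q ↦ ⟨g q, hg q, rfl⟩⟩
  · rw [← hg q, ← hg q', heq]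
    exact congrArg Subtype.val h
  · obtain ⟨g', hg'⟩ := exists_firstCol_eq v.2
    exact ⟨⟦⟨mapGL ℝ g', g', rfl⟩⟧, Subtype.ext (((heq _ _).mp (hg _)).trans hg')⟩

lemma card_primitivePairs_mul_lt (hN : 0 < N) (h : N < 23) :
    (primitivePairs N).card * N < 12 * ∑ v ∈ primitivePairs N, v.2.gcd N := by
  interval_cases N <;> decide +kernel

end CongruenceSubgroup

/-- A cusp form for `Gamma1 N` vanishes if its norm to level one, which is a form of weight
`k * (primitivePairs N).card`, decays too fast at infinity. -/
lemma CuspForm.eq_zero_of_card_primitivePairs_mul_lt {N : ℕ} [NeZero N] {k : ℕ}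
    (hk : k * (primitivePairs N).card * N < 12 * ∑ v ∈ primitivePairs N, v.2.gcd N)
    (f : CuspForm (Gamma1 N) k) : f = 0 := by
  obtain ⟨e, he⟩ := exists_quotient_equiv_primitivePairs N
  have hN : (0 : ℝ) < N := mod_cast NeZero.pos N
  suffices ModularForm.norm 𝒮ℒ f = 0 by
    rw [ModularForm.norm_eq_zero_iff] at this
    exact DFunLike.coe_injective this
  refine ModularForm.levelOne_eq_zero_of_isBigO_exp_s3 _
    (s := (∑ v ∈ primitivePairs N, v.2.gcd N : ℕ) / N) ?_ ?_
  · rw [Nat.card_congr e, Nat.card_eq_fintype_card, Fintype.card_coe, mul_div_assoc',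
      lt_div_iff₀ hN]
    exact mod_cast hk
  let := Fintype.ofFinite (𝒮ℒ ⧸ (Gamma1 N : Subgroup (GL (Fin 2) ℝ)).subgroupOf 𝒮ℒ)
  have hprod : (fun τ : ℍ ↦
      Real.exp (-2 * π * τ.im * ((∑ v ∈ primitivePairs N, v.2.gcd N : ℕ) / N))) =
      ∏ q, fun τ : ℍ ↦ Real.exp (-2 * π * τ.im * ((e q).1.2.gcd N / N)) := by
    ext τ
    rw [Finset.prod_apply, ← Real.exp_sum, ← Finset.mul_sum, ← Finset.sum_div,
      e.sum_comp fun v ↦ ((v.1.2.gcd N : ℕ) : ℝ),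
      Finset.sum_coe_sort _ fun v : ℕ × ℕ ↦ ((v.2.gcd N : ℕ) : ℝ), Nat.cast_sum]
  rw [ModularForm.coe_norm, hprod, Finset.prod_fn, Finset.prod_fn]
  refine .finsetProd fun q _ ↦ ?_
  obtain ⟨g, hg, hge⟩ := he q
  have hw : (N / (firstCol N g).2.gcd N : ℕ) = (N : ℝ) / (firstCol N g).2.gcd N :=
    Nat.cast_div (Nat.gcd_dvd_right _ _) (by simp [NeZero.ne N])
  have := CuspForm.slash_isBigO_exp_s3 f g⁻¹
    (Nat.div_pos (Nat.gcd_le_right _ (NeZero.pos N)) (Nat.gcd_pos_of_pos_right _ (NeZero.pos N)))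
    (inv_mul_T_pow_mul_mem_Gamma1 g)
  rw [← hge, ← hg, SlashInvariantForm.quotientFunc_mk, ← map_inv]
  refine this.congr_right fun τ ↦ ?_
  rw [hw, div_div_eq_mul_div, mul_div_assoc]

theorem weight_one_cuspforms_rank_zero_level_lt_23 (N : ℕ) (hN : 0 < N) (h : N < 23) :
    Module.rank ℂ (CuspForm (CongruenceSubgroup.Gamma1 N) 1) = 0 := by
  have : NeZero N := ⟨hN.ne'⟩
  refine rank_zero_iff_forall_zero.mpr fun f ↦
    CuspForm.eq_zero_of_card_primitivePairs_mul_lt (k := 1) ?_ f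
  simpa using card_primitivePairs_mul_lt hN h
end

section
/- The complex vector space S₁(Γ₁(23); ℂ) of weight 1 cusp forms of level Γ₁(23) has dimension exactly 1 over ℂ. -/
section

open UpperHalfPlane hiding I
open Complex hiding eta
open ModularForm Real Filter Topology
open scoped Matrix MatrixGroups Manifold

/-- The odd Jacobi theta function `θ₁` (up to normalisation). -/
noncomputable def oddTheta (z τ : ℂ) : ℂ :=
  cexp (π * I * τ / 4 + π * I * (z + 1 / 2)) * jacobiTheta₂ (z + 1 / 2 + τ / 2) τ

lemma oddTheta_add_one (z τ : ℂ) : oddTheta (z + 1) τ = -oddTheta z τ := by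
  rw [oddTheta, oddTheta, show z + 1 + 1 / 2 + τ / 2 = z + 1 / 2 + τ / 2 + 1 by ring,
    jacobiTheta₂_add_left, show π * I * τ / 4 + π * I * (z + 1 + 1 / 2) =
      π * I * τ / 4 + π * I * (z + 1 / 2) + π * I by ring, Complex.exp_add _ (π * I),
    Complex.exp_pi_mul_I]
  ring

lemma oddTheta_add_right (z τ : ℂ) :
    oddTheta (z + τ) τ = -(cexp (-π * I * (τ + 2 * z)) * oddTheta z τ) := by
  rw [oddTheta, oddTheta, show z + τ + 1 / 2 + τ / 2 = z + 1 / 2 + τ / 2 + τ by ring,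
    jacobiTheta₂_add_left', ← mul_assoc, ← mul_assoc, ← Complex.exp_add, ← Complex.exp_add,
    show π * I * τ / 4 + π * I * (z + τ + 1 / 2) + -π * I * (τ + 2 * (z + 1 / 2 + τ / 2)) =
     -π * I * (τ + 2 * z) + (π * I * τ / 4 + π * I * (z + 1 / 2)) - π * I by ring,
    Complex.exp_sub, Complex.exp_pi_mul_I]
  ring

lemma oddTheta_vadd_one (z τ : ℂ) : oddTheta z (τ + 1) = cexp (π * I / 4) * oddTheta z τ := by
  rw [oddTheta, oddTheta, ← mul_assoc, ← Complex.exp_add]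
  congr 1
  · congr 1; ring
  · refine tsum_congr fun n ↦ ?_
    obtain ⟨m, hm⟩ := Int.even_mul_succ_self n
    have hm' : (n : ℂ) * (n + 1) = m + m := by exact_mod_cast hm
    rw [jacobiTheta₂_term, jacobiTheta₂_term, Complex.exp_eq_exp_iff_exists_int]
    refine ⟨m, ?_⟩
    linear_combination (π * I) * hm'

lemma oddTheta_neg_inv (z : ℂ) {τ : ℂ} (hτ : 0 < τ.im) :
    oddTheta (z / τ) (-1 / τ) =
      -I * (-I * τ) ^ (1 / 2 : ℂ) * cexp (π * I * z ^ 2 / τ) * oddTheta z τ := by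
  have h0 : τ ≠ 0 := by rintro rfl; simp at hτ
  have h1 : (-I * τ) ^ (1 / 2 : ℂ) ≠ 0 := by
    simp [Complex.cpow_eq_zero_iff, h0]
  have h2 := jacobiTheta₂_functional_equation (z + τ / 2 - 1 / 2) τ
  rw [oddTheta, oddTheta, show z + 1 / 2 + τ / 2 = z + τ / 2 - 1 / 2 + 1 by ring,
    jacobiTheta₂_add_left, h2, show z / τ + 1 / 2 + -1 / τ / 2 = (z + τ / 2 - 1 / 2) / τ by
      field_simp; ring]
  have h3 : cexp (π * I * (-1 / τ) / 4 + π * I * (z / τ + 1 / 2)) =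
    -I * cexp (π * I * z ^ 2 / τ) * cexp (π * I * τ / 4 + π * I * (z + 1 / 2)) *
      cexp (-π * I * (z + τ / 2 - 1 / 2) ^ 2 / τ) := by
    rw [show -I = cexp (-π / 2 * I) by
      rw [neg_div, neg_mul, Complex.exp_neg, Complex.exp_pi_div_two_mul_I, inv_I],
      ← Complex.exp_add, ← Complex.exp_add, ← Complex.exp_add, Complex.exp_eq_exp_iff_exists_int]
    refine ⟨0, ?_⟩
    field_simp
    push_cast
    ring
  rw [h3]
  field_simp

lemma eta_add_one (τ : ℂ) : eta (τ + 1) = cexp (π * I / 12) * eta τ := by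
  rw [eta, eta, ← mul_assoc]
  congr 1
  · simp only [Function.Periodic.qParam]
    rw [← Complex.exp_add]
    congr 1
    push_cast
    ring
  · refine tprod_congr fun n ↦ ?_
    rw [eta_q_eq_pow, eta_q_eq_pow, mul_add, Complex.exp_add, mul_one, Complex.exp_two_pi_mul_I,
      mul_one]

lemma eta_neg_inv {τ : ℂ} (hτ : 0 < τ.im) :
    eta (-1 / τ) = (-I * τ) ^ (1 / 2 : ℂ) * eta τ := by
  have h := eta_comp_eq_csqrt_I_inv hτ
  simp only [Function.comp_apply, Pi.smul_apply, Pi.mul_apply, smul_eq_mul] at h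
  rw [h, ← mul_assoc]
  congr 1
  have h0 : τ ≠ 0 := by rintro rfl; simp at hτ
  rw [Complex.sqrt, Complex.sqrt, ← Complex.cpow_neg, Complex.cpow_def_of_ne_zero (by simp),
    Complex.cpow_def_of_ne_zero h0, Complex.cpow_def_of_ne_zero (by simp [h0]),
    Complex.log_mul (by simp) h0, Complex.log_neg_I, Complex.log_I, ← Complex.exp_add]
  · congr 1; ring
  · have h1 : 0 < Complex.arg τ := by
      refine lt_of_le_of_ne (Complex.arg_nonneg_iff.mpr hτ.le) fun h ↦ hτ.ne' ?_
      exact (Complex.arg_eq_zero_iff.mp h.symm).2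
    have h2 := Complex.arg_le_pi τ
    rw [Complex.arg_neg_I]
    constructor <;> linarith [Real.pi_pos]

/-- The Klein form with characteristic `x`. -/
noncomputable def kleinForm (x : Fin 2 → ℝ) (τ : ℍ) : ℂ :=
  cexp (π * I * x 0 * (x 0 * τ + x 1)) * oddTheta (x 0 * τ + x 1) τ / eta τ ^ 3

lemma kleinForm_slash_T (x : Fin 2 → ℝ) :
    kleinForm x ∣[(-1 : ℤ)] ModularGroup.T = kleinForm ![x 0, x 0 + x 1] := by
  ext τ
  rw [SL_slash_apply, ModularGroup.denom_apply, modular_T_smul]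
  simp only [ModularGroup.T, kleinForm, coe_vadd, Matrix.cons_val_zero, Matrix.cons_val_one]
  rw [show ((1 : ℝ) : ℂ) + τ = τ + 1 by push_cast; ring, oddTheta_vadd_one, eta_add_one]
  have : cexp (π * I / 12) ^ 3 = cexp (π * I / 4) := by
    rw [← Complex.exp_nat_mul]; congr 1; push_cast; ring
  rw [mul_pow, this]
  push_cast
  rw [show (x 0 : ℂ) * (τ + 1) + x 1 = x 0 * τ + (x 0 + x 1) by ring]
  have h1 := Complex.exp_ne_zero (π * I / 4)
  have h2 := eta_ne_zero τ.2
  field_simp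
  simp

lemma kleinForm_slash_S (x : Fin 2 → ℝ) :
    kleinForm x ∣[(-1 : ℤ)] ModularGroup.S = kleinForm ![x 1, -x 0] := by
  ext τ
  have h0 := τ.ne_zero
  have h1 : ((-I * τ) ^ (1 / 2 : ℂ)) ^ 2 = -I * τ := by
    rw [← Complex.cpow_nat_mul]
    simp
  rw [SL_slash_apply, ModularGroup.denom_S, modular_S_smul]
  simp only [kleinForm, Matrix.cons_val_zero, Matrix.cons_val_one]
  rw [show (-(τ : ℂ))⁻¹ = -1 / τ by field_simp, eta_neg_inv τ.2,
    show (x 0 : ℂ) * (-1 / τ) + x 1 = (x 1 * τ + (-x 0 : ℝ)) / τ by push_cast; field_simp; ring,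
    oddTheta_neg_inv _ τ.2]
  have h2 : cexp (π * I * x 1 * (x 1 * τ + (-x 0 : ℝ))) =
      cexp (π * I * x 0 * ((x 1 * τ + (-x 0 : ℝ)) / τ)) *
        cexp (π * I * (x 1 * τ + (-x 0 : ℝ)) ^ 2 / τ) := by
    rw [← Complex.exp_add]
    congr 1
    push_cast
    field_simp
    ring
  have h3 : (-I * τ : ℂ) ^ (1 / 2 : ℂ) ≠ 0 := fun h ↦ by
    rw [h] at h1; simp [h0] at h1
  have h4 := eta_ne_zero τ.2
  rw [h2, neg_neg, zpow_one]
  generalize (-I * τ : ℂ) ^ (1 / 2 : ℂ) = s at *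
  field_simp
  rw [h1]
  ring

lemma vecMul_map_intCast (x : Fin 2 → ℝ) (γ : SL(2, ℤ)) :
    x ᵥ* (γ.map (Int.castRingHom ℝ) : Matrix (Fin 2) (Fin 2) ℝ) =
      ![x 0 * γ 0 0 + x 1 * γ 1 0, x 0 * γ 0 1 + x 1 * γ 1 1] := by
  ext i
  fin_cases i <;> simp only [Matrix.vecMul, dotProduct, Fin.sum_univ_two] <;> rfl

lemma kleinForm_slash (x : Fin 2 → ℝ) (γ : SL(2, ℤ)) :
    kleinForm x ∣[(-1 : ℤ)] γ =
      kleinForm (x ᵥ* (γ.map (Int.castRingHom ℝ) : Matrix (Fin 2) (Fin 2) ℝ)) := by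
  have hγ : γ ∈ Subgroup.closure {ModularGroup.S, ModularGroup.T} := by
    simp [SpecialLinearGroup.SL2Z_generators]
  induction hγ using Subgroup.closure_induction generalizing x with
  | mem γ h =>
    obtain rfl | rfl := h
    · rw [kleinForm_slash_S]
      rw [vecMul_map_intCast]
      simp [ModularGroup.S]
    · rw [kleinForm_slash_T]
      rw [vecMul_map_intCast]
      simp [ModularGroup.T]
  | one => simp
  | mul a b _ _ ha hb =>
    rw [SlashAction.slash_mul, ha, hb, map_mul, Matrix.SpecialLinearGroup.coe_mul,
      Matrix.vecMul_vecMul]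
  | inv a _ ha =>
    have := ha (x ᵥ* ((a⁻¹).map (Int.castRingHom ℝ) : Matrix (Fin 2) (Fin 2) ℝ))
    rw [Matrix.vecMul_vecMul, ← Matrix.SpecialLinearGroup.coe_mul, ← map_mul] at this
    simp only [inv_mul_cancel, map_one, Matrix.SpecialLinearGroup.coe_one, Matrix.vecMul_one]
      at this
    conv_lhs => rw [← this]
    rw [← SlashAction.slash_mul, mul_inv_cancel, SlashAction.slash_one]

lemma kleinForm_add_int_snd (u v : ℝ) (n : ℤ) (τ : ℍ) :
    kleinForm ![u, v + n] τ = cexp (π * I * n * (1 + u)) * kleinForm ![u, v] τ := by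
  have h (z τ : ℂ) : oddTheta (z + n) τ = cexp (π * I * n) * oddTheta z τ := by
    induction n using Int.induction_on generalizing z with
    | zero => simp
    | succ n ih =>
      push_cast at ih ⊢
      rw [← add_assoc, oddTheta_add_one, ih, mul_add, Complex.exp_add, mul_one,
        Complex.exp_pi_mul_I]
      ring
    | pred n ih =>
      have := oddTheta_add_one (z + (- n - 1)) τ
      push_cast at ih this ⊢
      rw [add_assoc, sub_add_cancel, ih] at this
      rw [mul_sub, Complex.exp_sub, mul_one, Complex.exp_pi_mul_I]
      rw [div_neg, div_one, neg_mul, this, neg_neg]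
  simp only [kleinForm, Matrix.cons_val_zero, Matrix.cons_val_one]
  push_cast
  rw [← add_assoc, h, show π * I * u * (u * τ + v + n) = π * I * u * (u * τ + v) + π * I * n * u by
    ring, mul_add (π * I * n), Complex.exp_add, Complex.exp_add]
  ring_nf

lemma kleinForm_add_int_fst (u v : ℝ) (m : ℤ) (τ : ℍ) :
    kleinForm ![u + m, v] τ = cexp (π * I * m * (1 - v)) * kleinForm ![u, v] τ := by
  have h (u : ℝ) : kleinForm ![u + 1, v] τ = cexp (π * I * (1 - v)) * kleinForm ![u, v] τ := by
    simp only [kleinForm, Matrix.cons_val_zero, Matrix.cons_val_one]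
    push_cast
    rw [show ((u : ℂ) + 1) * τ + v = u * τ + v + τ by ring, oddTheta_add_right, mul_neg,
      ← mul_assoc, ← Complex.exp_add, ← mul_div_assoc, ← mul_assoc, ← Complex.exp_add, ← neg_mul]
    congr 2
    rw [show π * I * (1 - v) + π * I * u * (u * τ + v) =
      π * I * (u + 1) * (u * τ + v + τ) + -π * I * (τ + 2 * (u * τ + v)) + π * I by ring,
      Complex.exp_add _ (π * I), Complex.exp_pi_mul_I, mul_neg_one]
  induction m using Int.induction_on with
  | zero => simp
  | succ n ih =>
    push_cast at ih ⊢
    rw [← add_assoc, h, ih, ← mul_assoc, ← Complex.exp_add]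
    ring_nf
  | pred n ih =>
    have := h (u + (-n - 1))
    push_cast at ih this ⊢
    rw [add_assoc, sub_add_cancel, ih] at this
    rw [show π * I * (-n - 1) * (1 - v) = π * I * -n * (1 - v) - π * I * (1 - v) by ring,
      Complex.exp_sub, div_mul_eq_mul_div, this, mul_div_cancel_left₀ _ (Complex.exp_ne_zero _)]

lemma norm_kleinForm_add_int_fst (u v : ℝ) (m : ℤ) (τ : ℍ) :
    ‖kleinForm ![u + m, v] τ‖ = ‖kleinForm ![u, v] τ‖ := by
  rw [kleinForm_add_int_fst, norm_mul, Complex.norm_exp]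
  simp

lemma summable_exp_neg_sq_sub_abs :
    Summable fun n : ℤ ↦ Real.exp (-π * ((n + 1 : ℝ) ^ 2 - |(n + 1 : ℝ)|)) := by
  have := summable_pow_mul_jacobiTheta₂_term_bound (1 / 2) one_pos 0
  simp only [pow_zero, one_mul, mul_one_div_cancel (two_ne_zero' ℝ)] at this
  simpa [Function.comp_def] using (Equiv.addRight (1 : ℤ)).summable_iff.mpr this

lemma norm_kleinForm_le {u : ℝ} (hu₀ : 0 ≤ u) (hu₁ : u ≤ 1) (v : ℝ) {τ : ℍ} (hτ : 1 ≤ τ.im) :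
    ‖kleinForm ![u, v] τ‖ * ‖eta τ‖ ^ 3 ≤
      (∑' n : ℤ, Real.exp (-π * ((n + 1 : ℝ) ^ 2 - |(n + 1 : ℝ)|))) *
        Real.exp (-π * τ.im * (u - 1 / 2) ^ 2) := by
  simp only [kleinForm, Matrix.cons_val_zero, Matrix.cons_val_one]
  rw [norm_div, norm_pow, div_mul_cancel₀ _ (pow_ne_zero _ (norm_ne_zero_iff.mpr (eta_ne_zero τ.2))),
    oddTheta, ← mul_assoc, ← Complex.exp_add, norm_mul, mul_comm, ← le_div_iff₀ (by simp),
    jacobiTheta₂]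
  refine tsum_of_norm_bounded ((summable_exp_neg_sq_sub_abs.hasSum.mul_right _).div_const _)
    fun n ↦ ?_
  rw [le_div_iff₀ (by simp), norm_jacobiTheta₂_term, Complex.norm_exp, ← Real.exp_add,
    ← Real.exp_add, Real.exp_le_exp]
  have h1 : (π * I * u * (u * τ + v) + (π * I * τ / 4 + π * I * (u * τ + v + 1 / 2)) : ℂ).re =
      -π * τ.im * (u + 1 / 2) ^ 2 := by
    simp
    ring
  have h2 : (u * τ + v + 1 / 2 + τ / 2 : ℂ).im = (u + 1 / 2) * τ.im := by
    simp
    ring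
  rw [h1, h2]
  have h3 : 0 ≤ (n + 1 : ℝ) ^ 2 - |(n + 1 : ℝ)| := by
    rw [← sq_abs, sq, ← mul_sub_one]
    rcases eq_or_ne (n + 1) 0 with h | h
    · have : (n + 1 : ℝ) = 0 := by exact_mod_cast h
      simp [this]
    · have : (1 : ℝ) ≤ |(n + 1 : ℝ)| := by exact_mod_cast Int.one_le_abs h
      nlinarith
  have h4 : 0 ≤ (n + 1 : ℝ) * (2 * u - 1) + |(n + 1 : ℝ)| := by
    rcases abs_cases (n + 1 : ℝ) with ⟨h, h'⟩ | ⟨h, h'⟩ <;> rw [h] <;> nlinarith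
  have h5 := mul_nonneg pi_pos.le (mul_nonneg (sub_nonneg.mpr hτ) h3)
  have h6 := mul_nonneg pi_pos.le (mul_nonneg (zero_le_one.trans hτ) h4)
  rw [coe_im]
  linarith

lemma tendsto_jacobiTheta₂_atImInfty (v : ℝ) :
    Tendsto (fun τ : ℍ ↦ jacobiTheta₂ (v + 1 / 2 + τ / 2) τ) atImInfty
      (𝓝 (1 - cexp (-(2 * π * I * v)))) := by
  have key : ∑' n : ℤ, (if n = 0 then 1 else if n = -1 then -cexp (-(2 * π * I * v)) else 0) =
      1 - cexp (-(2 * π * I * v)) := by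
    rw [tsum_eq_sum (s := {0, -1}) (fun n hn ↦ by simp at hn; simp [hn])]
    simp [sub_eq_add_neg]
  rw [← key]
  have hnorm (n : ℤ) (τ : ℍ) : ‖jacobiTheta₂_term n (v + 1 / 2 + τ / 2) τ‖ =
      Real.exp (-π * τ.im * (n ^ 2 + n)) := by
    rw [norm_jacobiTheta₂_term]
    congr 1
    simp
    ring
  have hn (n : ℤ) : (0 : ℝ) ≤ n ^ 2 + n := by
    have : 0 ≤ n ^ 2 + n := by
      rcases le_or_gt 0 n with h | h <;> nlinarith
    exact_mod_cast this
  refine tendsto_tsum_of_dominated_convergence summable_exp_neg_sq_sub_abs (fun n ↦ ?_) ?_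
  · split_ifs with h h
    · subst h
      simp [jacobiTheta₂_term]
    · subst h
      refine tendsto_const_nhds.congr fun τ ↦ ?_
      rw [jacobiTheta₂_term, show 2 * π * I * (-1 : ℤ) * (v + 1 / 2 + (τ : ℂ) / 2) +
          π * I * (-1 : ℤ) ^ 2 * τ = -(2 * π * I * v) - π * I by push_cast; ring,
        Complex.exp_sub, Complex.exp_pi_mul_I, div_neg, div_one]
    · rw [tendsto_zero_iff_norm_tendsto_zero]
      simp_rw [hnorm]
      have : (0 : ℝ) < n ^ 2 + n := by
        have : (n : ℝ) ^ 2 + n ≠ 0 := by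
          intro h'
          have : n * (n + 1) = 0 := by
            have : (n : ℝ) * (n + 1) = 0 := by linarith
            exact_mod_cast this
          rcases mul_eq_zero.mp this with h1 | h1 <;> omega
        exact lt_of_le_of_ne (hn n) this.symm
      refine Real.tendsto_exp_atBot.comp ?_
      simp_rw [mul_assoc, neg_mul, tendsto_neg_atBot_iff]
      exact (tendsto_comap.atTop_mul_const this).const_mul_atTop pi_pos
  · filter_upwards [tendsto_comap.eventually_ge_atTop 1] with τ hτ n
    rw [hnorm, Real.exp_le_exp, mul_assoc, neg_mul, neg_mul, neg_le_neg_iff]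
    refine mul_le_mul_of_nonneg_left ?_ pi_pos.le
    refine le_trans ?_ (le_mul_of_one_le_left (hn n) hτ)
    rcases le_or_gt 0 n with h | h
    · have : (0 : ℝ) ≤ n := by exact_mod_cast h
      rw [abs_of_nonneg (by linarith)]
      nlinarith
    · have : (n : ℝ) + 1 ≤ 0 := by exact_mod_cast h
      rw [abs_of_nonpos this]
      nlinarith

/-- The product of `Δ` with the Klein forms of characteristic `(0, a / 23)`, `1 ≤ a ≤ 11`. -/
noncomputable def kleinProduct (τ : ℍ) : ℂ :=
  discriminant τ * ∏ a ∈ Finset.Icc 1 11, kleinForm ![0, (a : ℕ) / 23] τ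

lemma kleinProduct_slash (γ : SL(2, ℤ)) (τ : ℍ) :
    (kleinProduct ∣[(1 : ℤ)] γ) τ = discriminant τ *
      ∏ a ∈ Finset.Icc 1 11, kleinForm ![(a : ℕ) * γ 1 0 / 23, a * γ 1 1 / 23] τ := by
  have h1 : discriminant τ = (discriminant ∣[(12 : ℤ)] γ) τ := by
    rw [SlashInvariantForm.slash_action_generators_SL2Z discriminant_S_invariant
      discriminant_T_invariant]
  have h2 (a : ℕ) : kleinForm ![(a : ℕ) * γ 1 0 / 23, a * γ 1 1 / 23] τ =
      (kleinForm ![0, (a : ℕ) / 23] ∣[(-1 : ℤ)] γ) τ := by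
    rw [kleinForm_slash, vecMul_map_intCast]
    simp [div_mul_eq_mul_div]
  simp_rw [h1, h2, SL_slash_apply, kleinProduct, Finset.prod_mul_distrib]
  have h3 := denom_ne_zero (γ : GL (Fin 2) ℝ) τ
  simp only [Finset.prod_const, Nat.card_Icc]
  rw [← zpow_natCast, ← zpow_mul, mul_mul_mul_comm, ← zpow_add₀ h3]
  norm_num

lemma kleinProduct_slash_of_mem {γ : SL(2, ℤ)} (hγ : γ ∈ CongruenceSubgroup.Gamma1 23) :
    kleinProduct ∣[(1 : ℤ)] γ = kleinProduct := by
  ext τ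
  rw [CongruenceSubgroup.Gamma1_mem] at hγ
  obtain ⟨-, hd, hc⟩ := hγ
  obtain ⟨c, hc⟩ := (ZMod.intCast_zmod_eq_zero_iff_dvd _ 23).mp hc
  obtain ⟨d, hd⟩ := (ZMod.intCast_eq_intCast_iff_dvd_sub 1 _ 23).mp (by simpa using hd.symm)
  have hd : γ 1 1 = 1 + 23 * d := by push_cast at hd; linarith
  rw [kleinProduct_slash, kleinProduct, hc, hd]
  congr 1
  have h (a : ℕ) : kleinForm ![(a : ℕ) * ((23 : ℕ) * c : ℤ) / 23, a * (1 + 23 * d : ℤ) / 23] τ =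
      cexp (π * I * (a * (c + d) + a ^ 2 * (c * d - c / 23))) *
        kleinForm ![0, (a : ℕ) / 23] τ := by
    rw [show (a : ℝ) * ((23 : ℕ) * c : ℤ) / 23 = 0 + (a * c : ℤ) by push_cast; ring,
      show (a : ℝ) * (1 + 23 * d : ℤ) / 23 = a / 23 + (a * d : ℤ) by push_cast; ring,
      kleinForm_add_int_snd, kleinForm_add_int_fst, ← mul_assoc, ← Complex.exp_add]
    congr 2
    push_cast
    ring
  simp_rw [h, Finset.prod_mul_distrib, ← Complex.exp_sum, ← Finset.mul_sum,
    Finset.sum_add_distrib, ← Finset.sum_mul]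
  rw [show ∑ a ∈ Finset.Icc (1 : ℕ) 11, (a : ℂ) = 66 by norm_num [Finset.sum_Icc_succ_top],
    show ∑ a ∈ Finset.Icc (1 : ℕ) 11, (a : ℂ) ^ 2 = 506 by norm_num [Finset.sum_Icc_succ_top],
    show π * I * (66 * (c + d) + 506 * (c * d - c / 23) : ℂ) =
      (22 * c + 33 * d + 253 * c * d : ℤ) * (2 * π * I) by push_cast; ring,
    Complex.exp_int_mul_two_pi_mul_I, one_mul]

lemma lt_sum_sq_emod (c : ℤ) :
    1587 < ∑ a ∈ Finset.Icc 1 11, (2 * (((a : ℕ) * c) % 23) - 23) ^ 2 := by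
  have h (a : ℕ) : (a * c) % 23 = (a * (c % 23)) % 23 := by simp [Int.mul_emod]
  simp_rw [h]
  have h1 := Int.emod_nonneg c (by norm_num : (23 : ℤ) ≠ 0)
  have h2 := Int.emod_lt_of_pos c (by norm_num : (0 : ℤ) < 23)
  generalize c % 23 = r at *
  interval_cases r <;> decide

lemma norm_kleinProduct_slash_le (γ : SL(2, ℤ)) : ∃ C A : ℝ, 3 / 4 < A ∧ ∀ τ : ℍ, 1 ≤ τ.im →
    ‖(kleinProduct ∣[(1 : ℤ)] γ) τ‖ * ‖eta τ‖ ^ 9 ≤ C * Real.exp (-π * τ.im * A) := by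
  let r (a : ℕ) : ℝ := ((a * γ 1 0) % 23 : ℤ) / 23
  let C : ℝ := ∑' n : ℤ, Real.exp (-π * ((n + 1 : ℝ) ^ 2 - |(n + 1 : ℝ)|))
  refine ⟨C ^ 11, ∑ a ∈ Finset.Icc 1 11, (r a - 1 / 2) ^ 2, ?_, fun τ hτ ↦ ?_⟩
  · have h1 : ∑ a ∈ Finset.Icc 1 11, (r a - 1 / 2) ^ 2 =
        ((∑ a ∈ Finset.Icc 1 11, (2 * (((a : ℕ) * γ 1 0) % 23) - 23) ^ 2 : ℤ) : ℝ) / 46 ^ 2 := by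
      rw [Int.cast_sum, Finset.sum_div]
      refine Finset.sum_congr rfl fun a _ ↦ ?_
      simp only [r]
      push_cast
      ring
    have h2 : (1587 : ℝ) <
        ((∑ a ∈ Finset.Icc 1 11, (2 * (((a : ℕ) * γ 1 0) % 23) - 23) ^ 2 : ℤ) : ℝ) := by
      exact_mod_cast lt_sum_sq_emod (γ 1 0)
    rw [h1, lt_div_iff₀ (by norm_num)]
    linarith
  · have h1 (a : ℕ) : ‖kleinForm ![(a : ℕ) * γ 1 0 / 23, a * γ 1 1 / 23] τ‖ * ‖eta τ‖ ^ 3 ≤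
        C * Real.exp (-π * τ.im * (r a - 1 / 2) ^ 2) := by
      have h2 : (a : ℝ) * γ 1 0 / 23 = r a + ((a * γ 1 0) / 23 : ℤ) := by
        have : (a * γ 1 0 : ℝ) = ((a * γ 1 0) % 23 : ℤ) + 23 * ((a * γ 1 0) / 23 : ℤ) := by
          exact_mod_cast (Int.emod_add_mul_ediv _ _).symm
        simp only [r]
        linarith
      rw [h2, norm_kleinForm_add_int_fst]
      refine norm_kleinForm_le ?_ ?_ _ hτ
      · have := Int.emod_nonneg (a * γ 1 0) (by norm_num : (23 : ℤ) ≠ 0)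
        have : (0 : ℝ) ≤ ((a * γ 1 0) % 23 : ℤ) := by exact_mod_cast this
        positivity
      · have := (Int.emod_lt_of_pos (a * γ 1 0) (by norm_num : (0 : ℤ) < 23)).le
        have : (((a * γ 1 0) % 23 : ℤ) : ℝ) ≤ (23 : ℤ) := by exact_mod_cast this
        rw [div_le_one (by norm_num)]
        exact_mod_cast this
    calc _ = ∏ a ∈ Finset.Icc 1 11,
          (‖kleinForm ![(a : ℕ) * γ 1 0 / 23, a * γ 1 1 / 23] τ‖ * ‖eta τ‖ ^ 3) := by
          rw [kleinProduct_slash, norm_mul, norm_prod, Finset.prod_mul_distrib]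
          simp only [discriminant, Finset.prod_const, Nat.card_Icc, norm_pow]
          ring
      _ ≤ ∏ a ∈ Finset.Icc 1 11, (C * Real.exp (-π * τ.im * (r a - 1 / 2) ^ 2)) :=
          Finset.prod_le_prod (fun _ _ ↦ by positivity) fun a _ ↦ h1 a
      _ = _ := by
          simp only [Finset.prod_mul_distrib, Finset.prod_const, Nat.card_Icc, ← Real.exp_sum,
            ← Finset.mul_sum]

lemma isZeroAtImInfty_kleinProduct_slash (γ : SL(2, ℤ)) :
    IsZeroAtImInfty (kleinProduct ∣[(1 : ℤ)] γ) := by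
  obtain ⟨C, A, hA, hC⟩ := norm_kleinProduct_slash_le γ
  obtain ⟨D, hD⟩ := exp_isBigO_discriminant.bound
  have h1 : ∀ᶠ τ : ℍ in atImInfty, ‖(kleinProduct ∣[(1 : ℤ)] γ) τ ^ 8‖ ≤
      C ^ 8 * D ^ 3 * Real.exp (-((8 * A - 6) * π * τ.im)) := by
    filter_upwards [hD, tendsto_comap.eventually_ge_atTop 1] with τ h2 hτ
    rw [Real.norm_of_nonneg (Real.exp_pos _).le, discriminant, norm_pow] at h2
    have h3 := pow_le_pow_left₀ (by positivity) (hC τ hτ) 8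
    have h4 := pow_le_pow_left₀ (by positivity) h2 3
    have h5 : 0 ≤ ‖(kleinProduct ∣[(1 : ℤ)] γ) τ‖ ^ 8 := by positivity
    have h6 : 0 ≤ D ^ 3 := by
      have : 0 < ‖eta τ‖ := norm_pos_iff.mpr (eta_ne_zero τ.2)
      have := pos_of_mul_pos_left ((Real.exp_pos _).trans_le h2) (by positivity)
      positivity
    have h7 := mul_le_mul_of_nonneg_left h4 h5
    have h8 := mul_le_mul_of_nonneg_left h3 h6
    rw [norm_pow, ← mul_le_mul_iff_left₀ (Real.exp_pos (-6 * π * τ.im))]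
    calc _ = ‖(kleinProduct ∣[(1 : ℤ)] γ) τ‖ ^ 8 * Real.exp (-2 * π * τ.im) ^ 3 := by
          rw [← Real.exp_nat_mul]; congr 2; push_cast; ring
      _ ≤ D ^ 3 * (‖(kleinProduct ∣[(1 : ℤ)] γ) τ‖ * ‖eta τ‖ ^ 9) ^ 8 := by
          refine h7.trans_eq ?_; ring
      _ ≤ _ := h8
      _ = _ := by
          rw [mul_pow, ← Real.exp_nat_mul, mul_assoc (C ^ 8 * D ^ 3), ← Real.exp_add, mul_left_comm,
            ← mul_assoc]
          congr 2; push_cast; ring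
  have h2 : Tendsto (fun τ : ℍ ↦ C ^ 8 * D ^ 3 * Real.exp (-((8 * A - 6) * π * τ.im)))
      atImInfty (𝓝 0) := by
    rw [← mul_zero (C ^ 8 * D ^ 3)]
    refine (Real.tendsto_exp_neg_atTop_nhds_zero.comp ?_).const_mul _
    exact tendsto_comap.const_mul_atTop (mul_pos (by linarith) pi_pos)
  have h3 := squeeze_zero_norm' h1 h2
  exact (Asymptotics.isLittleO_one_iff ℂ).mp (Asymptotics.IsLittleO.of_pow (n := 8)
    (by simpa [Pi.pow_def] using (Asymptotics.isLittleO_one_iff ℂ).mpr h3) (by norm_num))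

lemma kleinProduct_ne_zero : kleinProduct ≠ 0 := by
  have h1 (a : ℕ) (ha : a ∈ Finset.Icc 1 11) :
      ∀ᶠ τ : ℍ in atImInfty, kleinForm ![0, (a : ℕ) / 23] τ ≠ 0 := by
    have h2 : 1 - cexp (-(2 * π * I * ((a / 23 : ℝ)))) ≠ 0 := by
      rw [sub_ne_zero, ne_comm, Ne, Complex.exp_eq_one_iff]
      rintro ⟨n, hn⟩
      have h3 : (a : ℂ) = (-23 * n : ℤ) := by
        have := Complex.two_pi_I_ne_zero
        push_cast at hn ⊢
        field_simp at hn
        linear_combination -hn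
      have h4 : (a : ℤ) = -23 * n := by exact_mod_cast h3
      rw [Finset.mem_Icc] at ha
      omega
    filter_upwards [(tendsto_jacobiTheta₂_atImInfty (a / 23 : ℝ)).eventually_ne h2] with τ hτ
    simpa [kleinForm, oddTheta, eta_ne_zero τ.2] using hτ
  intro h
  obtain ⟨τ, hτ⟩ := ((Filter.eventually_all_finset _).mpr h1).exists
  have := congrFun h τ
  simp only [kleinProduct, Pi.zero_apply, mul_eq_zero, discriminant_ne_zero, false_or,
    Finset.prod_eq_zero_iff] at this
  obtain ⟨a, ha, h⟩ := this
  exact hτ a ha h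

lemma mdifferentiable_kleinProduct : MDiff kleinProduct := by
  have h1 : DifferentiableOn ℂ (fun z ↦ eta z ^ 24 * ∏ a ∈ Finset.Icc 1 11,
      (oddTheta ((a : ℕ) / 23 : ℝ) z / eta z ^ 3)) {z | 0 < z.im} := by
    intro z hz
    have h2 := differentiableAt_eta_of_mem_upperHalfPlaneSet hz
    refine ((h2.pow 24).mul (DifferentiableAt.fun_finsetProd fun a _ ↦
      DifferentiableAt.div ?_ (h2.pow 3) (pow_ne_zero _ (eta_ne_zero hz)))).differentiableWithinAt
    unfold oddTheta
    refine (by fun_prop : DifferentiableAt ℂ _ z).mul ?_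
    exact (hasFDerivAt_jacobiTheta₂ _ hz).differentiableAt.comp (f := fun τ : ℂ ↦ (_, τ)) z
      (by fun_prop)
  rw [UpperHalfPlane.mdifferentiable_iff]
  refine h1.congr fun z hz ↦ ?_
  simp [kleinProduct, kleinForm, discriminant, ofComplex_apply_of_im_pos hz]

/-- The Klein form product as a cusp form. -/
noncomputable def kleinCuspForm : CuspForm (CongruenceSubgroup.Gamma1 23) 1 where
  toFun := kleinProduct
  slash_action_eq' A hA := by
    obtain ⟨A, hA, rfl⟩ := hA
    exact kleinProduct_slash_of_mem hA
  holo' := mdifferentiable_kleinProduct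
  zero_at_cusps' hc := by
    rw [Subgroup.IsArithmetic.isCusp_iff_isCusp_SL2Z] at hc
    rw [OnePoint.isZeroAt_iff_forall_SL2Z hc]
    exact fun γ _ ↦ isZeroAtImInfty_kleinProduct_slash γ

lemma qExpansion_coeff_eq_zero_of_isBigO {k : ℤ} (f : ModularForm 𝒮ℒ k) {E : ℝ}
    (hf : f =O[atImInfty] fun τ ↦ Real.exp (-2 * π * E * τ.im)) {n : ℕ} (hn : n < E) :
    (qExpansion 1 f).coeff n = 0 := by
  obtain ⟨C, hC⟩ := hf.bound
  obtain ⟨A, hA⟩ := (atImInfty_mem _).mp hC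
  have h1 : ∀ t : ℝ, max A 1 ≤ t →
      ‖(qExpansion 1 f).coeff n‖ ≤ C * Real.exp (-(2 * π * (E - n) * t)) := by
    intro t ht
    have ht0 : 0 < t := by linarith [le_max_right A 1]
    rw [ModularFormClass.qExpansion_coeff_eq_intervalIntegral f one_pos (by simp) n ht0,
      ofReal_one, div_one, one_mul]
    refine (intervalIntegral.norm_integral_le_of_norm_le_const (C := C *
      Real.exp (-(2 * π * (E - n) * t))) fun u _ ↦ ?_).trans_eq (by simp)
    have h2 := hA ⟨u + t * I, by simpa using ht0⟩ (by
      simpa [UpperHalfPlane.im] using (le_max_left A 1).trans ht)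
    rw [norm_mul, norm_div, norm_one, norm_pow, Function.Periodic.norm_qParam, ← Real.exp_nat_mul,
      one_div, ← Real.exp_neg]
    refine (mul_le_mul_of_nonneg_left h2 (Real.exp_pos _).le).trans_eq ?_
    rw [Real.norm_of_nonneg (Real.exp_pos _).le, mul_left_comm, ← Real.exp_add]
    congr 2
    simp [UpperHalfPlane.im]
    ring
  have h3 : Tendsto (fun t : ℝ ↦ C * Real.exp (-(2 * π * (E - n) * t))) atTop (𝓝 0) := by
    rw [← mul_zero C]
    refine (Real.tendsto_exp_neg_atTop_nhds_zero.comp ?_).const_mul _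
    exact tendsto_id.const_mul_atTop (mul_pos two_pi_pos (sub_pos.mpr hn))
  refine norm_le_zero_iff.mp (ge_of_tendsto h3 ?_)
  filter_upwards [eventually_ge_atTop (max A 1)] with t ht using h1 t ht

lemma levelOne_eq_zero_of_isBigO {k : ℤ} (f : ModularForm 𝒮ℒ k) {E : ℝ}
    (hE : (k.toNat : ℝ) / 12 < E)
    (hf : f =O[atImInfty] fun τ ↦ Real.exp (-2 * π * E * τ.im)) : f = 0 := by
  refine sturm_bound_levelOne (lt_of_lt_of_le (Nat.cast_lt.mpr (Nat.lt_succ_self _))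
    (PowerSeries.nat_le_order _ _ fun i hi ↦ qExpansion_coeff_eq_zero_of_isBigO f hf ?_))
  refine lt_of_le_of_lt ?_ hE
  refine le_trans ?_ (Nat.cast_div_le (m := k.toNat) (n := 12) (α := ℝ))
  exact_mod_cast Nat.lt_succ_iff.mp hi

lemma mapGL_T_pow (w : ℕ) : Matrix.SpecialLinearGroup.mapGL ℝ (ModularGroup.T ^ w) =
    Matrix.GeneralLinearGroup.upperRightHom (w : ℝ) := by
  have h (i j : Fin 2) : ((ModularGroup.T ^ w : SL(2, ℤ)) : Matrix (Fin 2) (Fin 2) ℤ) i j =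
      !![1, (w : ℤ); 0, 1] i j := by
    rw [← ModularGroup.coe_T_zpow, zpow_natCast]
  ext i j
  rw [Matrix.SpecialLinearGroup.mapGL_coe_matrix, Matrix.SpecialLinearGroup.map_apply_coe,
    RingHom.mapMatrix_apply, Matrix.map_apply, h]
  fin_cases i <;> fin_cases j <;> simp

lemma cuspForm_slash_isBigO (h : CuspForm (CongruenceSubgroup.Gamma1 23) 1) (γ : SL(2, ℤ)) {w : ℕ}
    (hw : 0 < w) (hγ : γ * ModularGroup.T ^ w * γ⁻¹ ∈ CongruenceSubgroup.Gamma1 23) :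
    (h ∣[(1 : ℤ)] γ) =O[atImInfty] fun τ ↦ Real.exp (-2 * π * (1 / w) * τ.im) := by
  have h1 := CuspFormClass.exp_decay_atImInfty (h := w) (CuspForm.translate h (γ : GL (Fin 2) ℝ))
    (by exact_mod_cast hw) (by
      rw [Subgroup.mem_strictPeriods_iff, map_inv, Subgroup.mem_inv_pointwise_smul_iff,
        ConjAct.toConjAct_smul]
      refine ⟨_, hγ, ?_⟩
      rw [map_mul, map_mul, map_inv]
      congr 2
      exact mapGL_T_pow w)
  refine h1.congr_right fun τ ↦ ?_
  congr 1
  ring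

lemma cuspForm_isBigO_of_deriv_eq_zero (h : CuspForm (CongruenceSubgroup.Gamma1 23) 1)
    (h0 : deriv (cuspFunction 1 h) 0 = 0) :
    h =O[atImInfty] fun τ ↦ Real.exp (-2 * π * 2 * τ.im) := by
  have hp : (1 : ℝ) ∈ (CongruenceSubgroup.Gamma1 23 : Subgroup (GL (Fin 2) ℝ)).strictPeriods := by
    simp
  have h1 := ModularFormClass.analyticAt_cuspFunction_zero h one_pos hp
  have h2 := (h1.hasFPowerSeriesAt.isBigO_sub_partialSum_pow 2).comp_tendsto
    (qParam_tendsto_atImInfty one_pos)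
  have h3 : cuspFunction 1 h 0 = 0 := CuspFormClass.cuspFunction_apply_zero h one_pos hp
  refine (h2.congr_left fun τ ↦ ?_).trans (Asymptotics.IsBigO.of_bound 1 (.of_forall fun τ ↦ ?_))
  · have h4 := eq_cuspFunction (h := 1) (f := h) τ one_ne_zero
      (SlashInvariantFormClass.periodic_comp_ofComplex h hp)
    simp [FormalMultilinearSeries.partialSum, Finset.sum_range_succ, h3, h0]
    exact h4
  · simp [Function.Periodic.norm_qParam, ← Real.exp_nat_mul]
    ring_nf
    exact le_rfl

lemma conj_T_mem_Gamma1 {N : ℕ} {γ : SL(2, ℤ)} (hγ : γ ∈ CongruenceSubgroup.Gamma0 N) :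
    γ * ModularGroup.T * γ⁻¹ ∈ CongruenceSubgroup.Gamma1 N := by
  rw [CongruenceSubgroup.Gamma0_mem] at hγ
  rw [CongruenceSubgroup.Gamma1_mem]
  simp only [Matrix.SpecialLinearGroup.coe_mul, Matrix.SpecialLinearGroup.coe_inv,
    Matrix.adjugate_fin_two, ModularGroup.coe_T]
  simp [Matrix.mul_apply, Fin.sum_univ_two, hγ]
  have hd := congrArg (Int.cast : ℤ → ZMod N) (Matrix.SpecialLinearGroup.det_coe γ)
  rw [Matrix.det_fin_two] at hd
  push_cast at hd
  rw [hγ] at hd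
  constructor <;> linear_combination hd

lemma conj_T_pow_mem_Gamma1 (N : ℕ) (γ : SL(2, ℤ)) :
    γ * ModularGroup.T ^ N * γ⁻¹ ∈ CongruenceSubgroup.Gamma1 N := by
  have hT : ModularGroup.T ^ N ∈ CongruenceSubgroup.Gamma N := by
    simpa using CongruenceSubgroup.ModularGroup_T_pow_mem_Gamma N N dvd_rfl
  have := (CongruenceSubgroup.Gamma_normal N).conj_mem _ hT γ
  rw [CongruenceSubgroup.Gamma_mem] at this
  rw [CongruenceSubgroup.Gamma1_mem]
  tauto

lemma exists_mul_T_pow_S_mem_Gamma0 {p : ℕ} [Fact p.Prime] (γ : SL(2, ℤ))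
    (hγ : γ ∉ CongruenceSubgroup.Gamma0 p) :
    ∃ j : ZMod p, (ModularGroup.T ^ j.val * ModularGroup.S)⁻¹ * γ ∈ CongruenceSubgroup.Gamma0 p := by
  rw [CongruenceSubgroup.Gamma0_mem] at hγ
  refine ⟨(γ 0 0 : ZMod p) / (γ 1 0 : ZMod p), ?_⟩
  have h (j : ℕ) : ((ModularGroup.T ^ j * ModularGroup.S)⁻¹ * γ) 1 0 = j * γ 1 0 - γ 0 0 := by
    rw [mul_inv_rev, ← zpow_natCast, ← zpow_neg, Matrix.SpecialLinearGroup.coe_mul,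
      Matrix.SpecialLinearGroup.coe_mul, ModularGroup.coe_T_zpow,
      Matrix.SpecialLinearGroup.coe_inv, ModularGroup.coe_S]
    simp [Matrix.adjugate_fin_two, Matrix.mul_apply, Fin.sum_univ_two]
    ring
  rw [CongruenceSubgroup.Gamma0_mem, h]
  push_cast
  rw [ZMod.natCast_val, ZMod.cast_id', id, div_mul_cancel₀ _ hγ, sub_self]

/-- The coset of `γ : SL(2, ℤ)` in `SL(2, ℤ) ⧸ Γ₁(N)`, both regarded as subgroups of `GL(2, ℝ)`. -/
def Gamma1Coset (N : ℕ) (γ : SL(2, ℤ)) :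
    𝒮ℒ ⧸ (CongruenceSubgroup.Gamma1 N : Subgroup (GL (Fin 2) ℝ)).subgroupOf 𝒮ℒ :=
  QuotientGroup.mk ⟨Matrix.SpecialLinearGroup.mapGL ℝ γ, γ, rfl⟩

lemma Gamma1Coset_surjective (N : ℕ) : Function.Surjective (Gamma1Coset N) := by
  rintro ⟨_, γ, rfl⟩
  exact ⟨γ, rfl⟩

/-- The cosets of `Γ₁(N)` contained in `Γ₀(N)`. -/
def Gamma0Cosets (N : ℕ) :
    Set (𝒮ℒ ⧸ (CongruenceSubgroup.Gamma1 N : Subgroup (GL (Fin 2) ℝ)).subgroupOf 𝒮ℒ) :=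
  Gamma1Coset N '' CongruenceSubgroup.Gamma0 N

lemma card_quotient_le (p : ℕ) [Fact p.Prime] :
    Nat.card (𝒮ℒ ⧸ (CongruenceSubgroup.Gamma1 p : Subgroup (GL (Fin 2) ℝ)).subgroupOf 𝒮ℒ) ≤
      (p + 1) * Nat.card (Gamma0Cosets p) := by
  let t : Option (ZMod p) → SL(2, ℤ) := fun o ↦ o.elim 1 fun j ↦
    ModularGroup.T ^ j.val * ModularGroup.S
  let φ : Option (ZMod p) × Gamma0Cosets p →
      𝒮ℒ ⧸ (CongruenceSubgroup.Gamma1 p : Subgroup (GL (Fin 2) ℝ)).subgroupOf 𝒮ℒ := fun x ↦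
    (⟨Matrix.SpecialLinearGroup.mapGL ℝ (t x.1), t x.1, rfl⟩ : 𝒮ℒ) • x.2.1
  have hφ : Function.Surjective φ := by
    intro q
    obtain ⟨γ, rfl⟩ := Gamma1Coset_surjective p q
    obtain ⟨o, ho⟩ : ∃ o, (t o)⁻¹ * γ ∈ CongruenceSubgroup.Gamma0 p := by
      by_cases hγ : γ ∈ CongruenceSubgroup.Gamma0 p
      · exact ⟨none, by simpa [t] using hγ⟩
      · obtain ⟨j, hj⟩ := exists_mul_T_pow_S_mem_Gamma0 γ hγ
        exact ⟨some j, hj⟩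
    refine ⟨(o, ⟨_, _, ho, rfl⟩), congrArg QuotientGroup.mk (Subtype.ext ?_)⟩
    change Matrix.SpecialLinearGroup.mapGL ℝ (t o) *
      Matrix.SpecialLinearGroup.mapGL ℝ ((t o)⁻¹ * γ) = Matrix.SpecialLinearGroup.mapGL ℝ γ
    rw [← map_mul, mul_inv_cancel_left]
  refine (Nat.card_le_card_of_surjective φ hφ).trans_eq ?_
  rw [Nat.card_prod, Nat.card_eq_fintype_card, Fintype.card_option, ZMod.card]

lemma cuspForm_eq_zero_of_deriv_eq_zero (h : CuspForm (CongruenceSubgroup.Gamma1 23) 1)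
    (h0 : deriv (cuspFunction 1 h) 0 = 0) : h = 0 := by
  classical
  have : Fact (Nat.Prime 23) := ⟨by norm_num⟩
  let 𝒬 := 𝒮ℒ ⧸ (CongruenceSubgroup.Gamma1 23 : Subgroup (GL (Fin 2) ℝ)).subgroupOf 𝒮ℒ
  let := Fintype.ofFinite 𝒬
  let d : 𝒬 → ℝ := fun q ↦ if q = Gamma1Coset 23 1 then 1 else 0
  let e : 𝒬 → ℝ := fun q ↦ 1 / 23 + (if q ∈ Gamma0Cosets 23 then 22 / 23 else 0) + d q
  have he (q : 𝒬) : SlashInvariantForm.quotientFunc h q =O[atImInfty]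
      fun τ ↦ Real.exp (-2 * π * e q * τ.im) := by
    by_cases hq1 : q = Gamma1Coset 23 1
    · have hA : q ∈ Gamma0Cosets 23 := ⟨1, one_mem _, hq1.symm⟩
      have hf : SlashInvariantForm.quotientFunc h q = h := by
        rw [hq1, Gamma1Coset]
        change (h : ℍ → ℂ) ∣[(1 : ℤ)] (Matrix.SpecialLinearGroup.mapGL ℝ (1 : SL(2, ℤ)))⁻¹ = h
        simp
      rw [hf, show e q = 2 by simp only [e, d, if_pos hA, if_pos hq1]; norm_num]
      exact cuspForm_isBigO_of_deriv_eq_zero h h0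
    have hs (γ : SL(2, ℤ)) : SlashInvariantForm.quotientFunc h (Gamma1Coset 23 γ) =
        (h : ℍ → ℂ) ∣[(1 : ℤ)] γ⁻¹ := by
      change (h : ℍ → ℂ) ∣[(1 : ℤ)] (Matrix.SpecialLinearGroup.mapGL ℝ γ)⁻¹ = _
      rw [← map_inv]
      rfl
    by_cases hA : q ∈ Gamma0Cosets 23
    · obtain ⟨γ, hγ, hγq⟩ := id hA
      rw [show e q = 1 / (1 : ℕ) by simp only [e, d, if_pos hA, if_neg hq1]; norm_num, ← hγq, hs]
      exact cuspForm_slash_isBigO h _ one_pos (by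
        rw [pow_one]
        exact conj_T_mem_Gamma1 (inv_mem hγ))
    · obtain ⟨γ, hγq⟩ := Gamma1Coset_surjective 23 q
      rw [show e q = 1 / (23 : ℕ) by simp [e, d, hA, hq1], ← hγq, hs]
      exact cuspForm_slash_isBigO h _ (by norm_num) (conj_T_pow_mem_Gamma1 23 _)
  have hsum : (Nat.card 𝒬 : ℝ) / 12 < ∑ q, e q := by
    have h1 : ∑ q, e q = Nat.card 𝒬 / 23 + 22 / 23 * Nat.card (Gamma0Cosets 23) + 1 := by
      have h3 : ∑ q, d q = 1 := by
        exact Fintype.sum_ite_eq' _ _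
      simp only [e, Finset.sum_add_distrib, h3, Finset.sum_ite, Finset.sum_const_zero,
        Finset.sum_const, add_zero, nsmul_eq_mul, Finset.card_univ, Nat.card_eq_fintype_card,
        Fintype.card_subtype]
      ring
    have h2 : (Nat.card 𝒬 : ℝ) ≤ 24 * Nat.card (Gamma0Cosets 23) := by
      exact_mod_cast card_quotient_le 23
    rw [h1]
    linarith
  refine DFunLike.coe_injective ((ModularForm.norm_eq_zero_iff 𝒮ℒ h).mp
    (levelOne_eq_zero_of_isBigO (E := ∑ q, e q) _ (by simpa using hsum) ?_))
  rw [ModularForm.coe_norm]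
  have hprod := Asymptotics.IsBigO.finsetProd (s := Finset.univ) fun q _ ↦ he q
  refine (hprod.congr_left fun τ ↦ ?_).congr_right fun τ ↦ ?_
  · rw [Finset.prod_apply]
  · rw [← Real.exp_sum, ← Finset.sum_mul, ← Finset.mul_sum]

lemma rank_cuspForm_le_one {f : CuspForm (CongruenceSubgroup.Gamma1 23) 1} (hf : f ≠ 0) :
    Module.rank ℂ (CuspForm (CongruenceSubgroup.Gamma1 23) 1) ≤ 1 := by
  have hp : (1 : ℝ) ∈ (CongruenceSubgroup.Gamma1 23 : Subgroup (GL (Fin 2) ℝ)).strictPeriods := by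
    simp
  have hcoeff (g : CuspForm (CongruenceSubgroup.Gamma1 23) 1)
      (hg : (qExpansion 1 g).coeff 1 = 0) : g = 0 := by
    refine cuspForm_eq_zero_of_deriv_eq_zero g ?_
    simpa [qExpansion_coeff] using hg
  have hf1 : (qExpansion 1 f).coeff 1 ≠ 0 := mt (hcoeff f) hf
  refine rank_le_one_iff.mpr ⟨f, fun g ↦
    ⟨(qExpansion 1 g).coeff 1 / (qExpansion 1 f).coeff 1, sub_eq_zero.mp (hcoeff _ ?_)⟩⟩
  have h1 := ModularFormClass.analyticAt_cuspFunction_zero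
    (((qExpansion 1 g).coeff 1 / (qExpansion 1 f).coeff 1) • f) one_pos hp
  rw [FunLike.coe_sub, qExpansion_sub h1
    (ModularFormClass.analyticAt_cuspFunction_zero g one_pos hp), FunLike.coe_smul,
    qExpansion_smul (ModularFormClass.analyticAt_cuspFunction_zero f one_pos hp)]
  simp [div_mul_cancel₀ _ hf1]

end

theorem weight_one_cuspforms_level_23_rank_one :
    Module.rank ℂ (CuspForm (CongruenceSubgroup.Gamma1 23) 1) = 1 := by
  have hf : kleinCuspForm ≠ 0 := fun h ↦ kleinProduct_ne_zero (congrArg DFunLike.coe h)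
  have : Nontrivial (CuspForm (CongruenceSubgroup.Gamma1 23) 1) := ⟨_, _, hf⟩
  exact le_antisymm (rank_cuspForm_le_one hf) (Cardinal.one_le_iff_pos.mpr rank_pos)
end
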